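/- Let m≥1 and β=(β_1,…,β_m), where β∈[0,∞)^m if m≥2 and β_1>−1 is allowed if m=1; write β=β_1+…+β_m. There exist constants 0<c≤C depending only on m and the parameters such that for every v∈S_+^{m−1} with all coordinates v_i>0 and every s∈(max{s_1(v),0},‖v‖_1), where s_1(v)=‖v‖_1−2 min_i v_i, one has c·(‖v‖_1−s)^{β+m−1}·∏_{i=1}^m v_i^{−β_i−1} ≤ Vol_{m−1}(C(v,s);β) ≤ C·(‖v‖_1−s)^{β+m−1}·∏_{i=1}^m v_i^{−β_i−1}. -/

import Mathlib

open MeasureTheory Filter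
open scoped RealInnerProductSpace

noncomputable section

/-- Normalizing constant `c_β = c_{β,1}` of the one-dimensional beta density on `[−1,1]`. -/
def betaConst1 (β : ℝ) : ℝ :=
  Real.Gamma (3 / 2 + β) / (Real.pi ^ ((1 : ℝ) / 2) * Real.Gamma (β + 1))

/-- The meta-section `C(v,s) = [−1,1]^m ∩ H(v,s)`. -/
def metaSection {m : ℕ} (v : EuclideanSpace ℝ (Fin m)) (s : ℝ) :
    Set (EuclideanSpace ℝ (Fin m)) :=
  {y | (∀ i, |y i| ≤ 1) ∧ ⟪y, v⟫ = s}

/-- The `β`-weighted `(m−1)`-dimensional Hausdorff measure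
`Vol_{m−1}(C(v,s);β) = ∫_{C(v,s)} ∏_i c_{β_i}(1−y_i²)^{β_i} dH^{m−1}(y)`
of the meta-section. -/
def metaSectionContent {m : ℕ} (β : Fin m → ℝ) (v : EuclideanSpace ℝ (Fin m))
    (s : ℝ) : ℝ :=
  ∫ y in metaSection v s, (∏ i, betaConst1 (β i) * (1 - y i ^ 2) ^ (β i))
    ∂(μH[(m : ℝ) - 1])

lemma betaConst1_pos {b : ℝ} (hb : -1 < b) : 0 < betaConst1 b := by
  unfold betaConst1
  have h1 := Real.Gamma_pos_of_pos (show 0 < 3 / 2 + b by linarith)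
  have h2 := Real.Gamma_pos_of_pos (show 0 < b + 1 by linarith)
  have := Real.pi_pos
  positivity

/-- The parametrization of the hyperplane `{y | ⟪y, v⟫ = s}` by all coordinates but the `i`-th. -/
def hyperplaneGraph {n : ℕ} (v : EuclideanSpace ℝ (Fin (n + 1))) (s : ℝ) (i : Fin (n + 1))
    (x : Fin n → ℝ) : EuclideanSpace ℝ (Fin (n + 1)) :=
  WithLp.toLp 2 (i.insertNth ((s - ∑ j, v (i.succAbove j) * x j) / v i) x)

lemma inner_eq_sum_mul {m : ℕ} (y v : EuclideanSpace ℝ (Fin m)) : ⟪y, v⟫ = ∑ i, v i * y i := by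
  simp [PiLp.inner_apply]

lemma inner_hyperplaneGraph {n : ℕ} {v : EuclideanSpace ℝ (Fin (n + 1))} (s : ℝ)
    {i : Fin (n + 1)} (hv : v i ≠ 0) (x : Fin n → ℝ) :
    ⟪hyperplaneGraph v s i x, v⟫ = s := by
  rw [inner_eq_sum_mul, Fin.sum_univ_succAbove _ i]
  simp [hyperplaneGraph]
  field_simp
  ring

lemma hyperplaneGraph_comp_succAbove {n : ℕ} {v : EuclideanSpace ℝ (Fin (n + 1))} {s : ℝ}
    {i : Fin (n + 1)} (hv : v i ≠ 0) {y : EuclideanSpace ℝ (Fin (n + 1))} (hy : ⟪y, v⟫ = s) :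
    hyperplaneGraph v s i (fun j => y (i.succAbove j)) = y := by
  rw [inner_eq_sum_mul, Fin.sum_univ_succAbove _ i] at hy
  ext k
  refine Fin.succAboveCases i ?_ (fun j => ?_) k
  · simp [hyperplaneGraph]
    field_simp
    linarith
  · simp [hyperplaneGraph]

lemma lipschitzWith_hyperplaneGraph {n : ℕ} {v : EuclideanSpace ℝ (Fin (n + 1))} (s : ℝ)
    {i : Fin (n + 1)} (hv : ∀ j, 0 < v j) (hi : ∀ j, v j ≤ v i) :
    LipschitzWith (2 * n) (hyperplaneGraph v s i) := by
  refine LipschitzWith.of_dist_le_mul fun x y => ?_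
  have hcoord : ∀ j, |x j - y j| ≤ dist x y := fun j => by
    rw [← Real.dist_eq]; exact dist_le_pi_dist x y j
  have hnorm : ∀ w : EuclideanSpace ℝ (Fin (n + 1)), ‖w‖ ≤ ∑ j, |w j| := fun w => by
    rw [EuclideanSpace.norm_eq]
    refine Real.sqrt_le_left (Finset.sum_nonneg fun j _ => abs_nonneg _) |>.2 ?_
    simpa using Finset.sum_sq_le_sq_sum_of_nonneg (s := Finset.univ) (f := fun j => |w j|)
      (fun j _ => abs_nonneg _)
  rw [dist_eq_norm]
  refine (hnorm _).trans ?_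
  rw [Fin.sum_univ_succAbove _ i]
  have h1 : |(hyperplaneGraph v s i x - hyperplaneGraph v s i y) i| ≤ n * dist x y := by
    have : (hyperplaneGraph v s i x - hyperplaneGraph v s i y) i =
        ∑ j, (v (i.succAbove j) / v i) * (y j - x j) := by
      simp only [hyperplaneGraph, PiLp.sub_apply, Fin.insertNth_apply_same]
      simp only [mul_sub, Finset.sum_sub_distrib, div_mul_eq_mul_div, ← Finset.sum_div]
      ring
    rw [this]
    refine (Finset.abs_sum_le_sum_abs _ _).trans ?_
    refine (Finset.sum_le_card_nsmul _ _ (dist x y) fun j _ => ?_).trans (by simp)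
    rw [abs_mul, abs_sub_comm, abs_of_pos (div_pos (hv _) (hv _))]
    have := (div_le_one (hv i)).2 (hi (i.succAbove j))
    exact (mul_le_of_le_one_left (abs_nonneg _) this).trans (hcoord j)
  have h2 : ∑ j, |(hyperplaneGraph v s i x - hyperplaneGraph v s i y) (i.succAbove j)|
      ≤ n * dist x y := by
    refine (Finset.sum_le_card_nsmul _ _ (dist x y) fun j _ => ?_).trans (by simp)
    simpa [hyperplaneGraph] using hcoord j
  push_cast
  linarith

lemma lipschitzWith_comp_succAbove {n : ℕ} (i : Fin (n + 1)) :
    LipschitzWith 1 (fun (y : EuclideanSpace ℝ (Fin (n + 1))) (j : Fin n) =>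
      y (i.succAbove j)) := by
  refine LipschitzWith.of_dist_le_mul fun x y => ?_
  rw [NNReal.coe_one, one_mul, dist_pi_le_iff dist_nonneg]
  intro j
  simpa [dist_eq_norm] using PiLp.norm_apply_le (x - y) (i.succAbove j)

lemma hausdorffMeasure_Icc_pi {n : ℕ} (a b : Fin n → ℝ) :
    μH[(n : ℝ)] (Set.Icc a b) = ∏ j, ENNReal.ofReal (b j - a j) := by
  have h := hausdorffMeasure_pi_real (ι := Fin n)
  rw [Fintype.card_fin] at h
  rw [h, Real.volume_Icc_pi]

lemma hausdorffMeasure_le_of_comp_succAbove_mem_Icc {n : ℕ}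
    {v : EuclideanSpace ℝ (Fin (n + 1))} {s : ℝ} {i : Fin (n + 1)} (hv : ∀ j, 0 < v j)
    (hi : ∀ j, v j ≤ v i) {T : Set (EuclideanSpace ℝ (Fin (n + 1)))} {a b : Fin n → ℝ}
    (hab : a ≤ b) (hT : ∀ y ∈ T, ⟪y, v⟫ = s)
    (hTab : ∀ y ∈ T, (fun j => y (i.succAbove j)) ∈ Set.Icc a b) :
    μH[(n : ℝ)] T ≤ ENNReal.ofReal ((2 * n) ^ n * ∏ j, (b j - a j)) := by
  have hsub : T ⊆ hyperplaneGraph v s i '' Set.Icc a b := fun y hy =>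
    ⟨_, hTab y hy, hyperplaneGraph_comp_succAbove (hv i).ne' (hT y hy)⟩
  refine (measure_mono hsub).trans
    (((lipschitzWith_hyperplaneGraph s hv hi).hausdorffMeasure_image_le n.cast_nonneg _).trans
      (le_of_eq ?_))
  rw [hausdorffMeasure_Icc_pi, ENNReal.ofReal_mul (by positivity),
    ENNReal.ofReal_prod_of_nonneg (fun j _ => sub_nonneg.2 (hab j)), ENNReal.rpow_natCast,
    ENNReal.ofReal_pow (by positivity)]
  congr 2
  rw [ENNReal.ofReal_mul (by norm_num)]
  simp

lemma le_hausdorffMeasure_of_Icc {n : ℕ}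
    {v : EuclideanSpace ℝ (Fin (n + 1))} {s : ℝ} {i : Fin (n + 1)}
    {T : Set (EuclideanSpace ℝ (Fin (n + 1)))} {a b : Fin n → ℝ}
    (hab : a ≤ b) (hTab : ∀ x ∈ Set.Icc a b, hyperplaneGraph v s i x ∈ T) :
    ENNReal.ofReal (∏ j, (b j - a j)) ≤ μH[(n : ℝ)] T := by
  have hsub : Set.Icc a b ⊆ (fun (y : EuclideanSpace ℝ (Fin (n + 1))) (j : Fin n) =>
      y (i.succAbove j)) '' T := fun x hx =>
    ⟨_, hTab x hx, by ext j; simp [hyperplaneGraph]⟩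
  have h := (measure_mono (μ := μH[(n : ℝ)]) hsub).trans
    ((lipschitzWith_comp_succAbove i).hausdorffMeasure_image_le n.cast_nonneg T)
  rw [hausdorffMeasure_Icc_pi] at h
  rw [ENNReal.ofReal_prod_of_nonneg (fun j _ => sub_nonneg.2 (hab j))]
  simpa using h

lemma one_sub_mul_le_of_mem_metaSection {m : ℕ} {v y : EuclideanSpace ℝ (Fin m)} {s : ℝ}
    (hv : ∀ i, 0 < v i) (hy : y ∈ metaSection v s) (i : Fin m) :
    v i * (1 - y i) ≤ (∑ j, v j) - s := by
  obtain ⟨hy1, hy2⟩ := hy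
  rw [inner_eq_sum_mul] at hy2
  rw [← hy2, ← Finset.sum_sub_distrib]
  have h := Finset.single_le_sum (f := fun j => v j * (1 - y j)) (s := Finset.univ)
    (fun j _ => mul_nonneg (hv j).le (by linarith [(abs_le.1 (hy1 j)).2])) (Finset.mem_univ i)
  simpa [mul_sub] using h

lemma isClosed_metaSection {m : ℕ} (v : EuclideanSpace ℝ (Fin m)) (s : ℝ) :
    IsClosed (metaSection v s) := by
  refine IsClosed.inter (s₁ := {y : EuclideanSpace ℝ (Fin m) | ∀ i, |y i| ≤ 1}) ?_ ?_
  · simp only [Set.ofPred_forall]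
    exact isClosed_iInter fun i => isClosed_le (by fun_prop) continuous_const
  · exact isClosed_eq (by fun_prop) continuous_const

/-- The product of one-dimensional beta densities. -/
def betaDensity {m : ℕ} (β : Fin m → ℝ) (y : EuclideanSpace ℝ (Fin m)) : ℝ :=
  ∏ i, betaConst1 (β i) * (1 - y i ^ 2) ^ (β i)

lemma continuous_betaDensity {m : ℕ} {β : Fin m → ℝ} (hβ : ∀ i, 0 ≤ β i) :
    Continuous (betaDensity β) := by
  refine continuous_finsetProd _ fun i _ => continuous_const.mul ?_
  exact (by fun_prop : Continuous fun y : EuclideanSpace ℝ (Fin m) => 1 - y i ^ 2).rpow_const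
    fun _ => Or.inr (hβ i)

lemma betaDensity_nonneg {m : ℕ} {β : Fin m → ℝ} (hβ : ∀ i, 0 ≤ β i)
    {y : EuclideanSpace ℝ (Fin m)} (hy : ∀ i, |y i| ≤ 1) : 0 ≤ betaDensity β y :=
  Finset.prod_nonneg fun i _ => mul_nonneg (betaConst1_pos (by linarith [hβ i])).le
    (Real.rpow_nonneg (by rw [sub_nonneg]; exact (sq_le_one_iff_abs_le_one _).2 (hy i)) _)

lemma prod_betaConst1_mul_rpow {m : ℕ} (β : Fin m → ℝ) {v : Fin m → ℝ} {a D : ℝ}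
    (ha : 0 ≤ a) (hD : 0 < D) (hv : ∀ i, 0 < v i) :
    ∏ i, betaConst1 (β i) * (a * D / v i) ^ (β i) =
      (∏ i, betaConst1 (β i) * a ^ (β i)) * D ^ (∑ i, β i) * ∏ i, v i ^ (-(β i)) := by
  rw [Real.rpow_sum_of_pos hD, ← Finset.prod_mul_distrib, ← Finset.prod_mul_distrib]
  refine Finset.prod_congr rfl fun i _ => ?_
  rw [Real.div_rpow (by positivity) (hv i).le, Real.mul_rpow ha hD.le, Real.rpow_neg (hv i).le]
  ring

lemma prod_rpow_neg_sub_one {m : ℕ} (β : Fin m → ℝ) {v : Fin m → ℝ} (hv : ∀ i, 0 < v i) :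
    ∏ i, v i ^ (-(β i) - 1) = (∏ i, v i ^ (-(β i))) / ∏ i, v i := by
  rw [← Finset.prod_div_distrib]
  exact Finset.prod_congr rfl fun i _ => Real.rpow_sub_one (hv i).ne' _

lemma prod_const_div_succAbove {n : ℕ} {v : Fin (n + 1) → ℝ} (hv : ∀ j, 0 < v j)
    (i : Fin (n + 1)) (D : ℝ) :
    ∏ j, D / v (i.succAbove j) = D ^ n * v i / ∏ j, v j := by
  have := (hv i).ne'
  have h2 : ∏ j, v (i.succAbove j) ≠ 0 := Finset.prod_ne_zero_iff.2 fun j _ => (hv _).ne'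
  rw [Fin.prod_univ_succAbove _ i, Finset.prod_div_distrib]
  simp
  field_simp

/-- The part of the meta-section where all barycentric coordinates are at least `1 / (2 m)`. -/
def metaSectionCore {m : ℕ} (v : EuclideanSpace ℝ (Fin m)) (s : ℝ) :
    Set (EuclideanSpace ℝ (Fin m)) :=
  {y | (∀ i, ((∑ j, v j) - s) / (2 * m) ≤ v i * (1 - y i)) ∧ ⟪y, v⟫ = s}

lemma isClosed_metaSectionCore {m : ℕ} (v : EuclideanSpace ℝ (Fin m)) (s : ℝ) :
    IsClosed (metaSectionCore v s) := by
  refine IsClosed.inter (s₁ := {y : EuclideanSpace ℝ (Fin m) |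
    ∀ i, ((∑ j, v j) - s) / (2 * m) ≤ v i * (1 - y i)}) ?_ ?_
  · simp only [Set.ofPred_forall]
    exact isClosed_iInter fun i => isClosed_le continuous_const (by fun_prop)
  · exact isClosed_eq (by fun_prop) continuous_const

section

variable {n : ℕ} {v y : EuclideanSpace ℝ (Fin (n + 1))} {s : ℝ}

lemma bounds_of_mem_metaSectionCore (hn : 1 ≤ n) (hv : ∀ i, 0 < v i) (hs : s < ∑ i, v i)
    (hsv : ∀ i, (∑ j, v j) - s < 2 * v i) (hy : y ∈ metaSectionCore v s) (i : Fin (n + 1)) :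
    ((∑ j, v j) - s) / (2 * (n + 1)) / v i ≤ 1 - y i ∧ 1 / ((n : ℝ) + 1) ≤ 1 + y i := by
  obtain ⟨hy1, hy2⟩ := hy
  push_cast at hy1
  set D := (∑ j, v j) - s with hD
  have hDpos : 0 < D := sub_pos.2 hs
  refine ⟨by rw [div_le_iff₀ (hv i), mul_comm (1 - y i)]; exact hy1 i, ?_⟩
  rw [inner_eq_sum_mul] at hy2
  have hsum : ∑ j, v j * (1 - y j) = D := by
    simp [mul_sub, hD, hy2]
  rw [Fin.sum_univ_succAbove _ i] at hsum
  have hpos : ∀ j, 0 ≤ v j * (1 - y j) := fun j => le_trans (by positivity) (hy1 j)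
  have h1 := Finset.single_le_sum (f := fun j => v (i.succAbove j) * (1 - y (i.succAbove j)))
    (s := Finset.univ) (fun j _ => hpos _) (Finset.mem_univ ⟨0, hn⟩)
  have h2 := hy1 (i.succAbove ⟨0, hn⟩)
  have h3 : v i * (1 - y i) ≤ D - D / (2 * (n + 1)) := by
    dsimp only at h1
    linarith
  have h4 : D - D / (2 * (n + 1)) = D / 2 * (2 - 1 / (n + 1)) := by field_simp
  have h5 : D / 2 * (2 - 1 / ((n : ℝ) + 1)) ≤ v i * (2 - 1 / (n + 1)) := by
    refine mul_le_mul_of_nonneg_right (by linarith [hsv i]) ?_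
    have : 1 / ((n : ℝ) + 1) ≤ 1 := by
      rw [div_le_one (by positivity)]
      linarith [(n.cast_nonneg : (0 : ℝ) ≤ n)]
    linarith
  have h6 := le_of_mul_le_mul_left (h3.trans (h4.le.trans h5)) (hv i)
  linarith

lemma metaSectionCore_subset (hn : 1 ≤ n) (hv : ∀ i, 0 < v i) (hs : s < ∑ i, v i)
    (hsv : ∀ i, (∑ j, v j) - s < 2 * v i) : metaSectionCore v s ⊆ metaSection v s := by
  intro y hy
  refine ⟨fun i => abs_le.2 ?_, hy.2⟩
  obtain ⟨h1, h2⟩ := bounds_of_mem_metaSectionCore hn hv hs hsv hy i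
  have h3 : 0 ≤ ((∑ j, v j) - s) / (2 * (n + 1)) / v i :=
    div_nonneg (div_nonneg (sub_pos.2 hs).le (by positivity)) (hv i).le
  have h4 : (0 : ℝ) ≤ 1 / ((n : ℝ) + 1) := by positivity
  constructor <;> linarith

lemma le_betaDensity_of_mem_metaSectionCore {β : Fin (n + 1) → ℝ} (hβ : ∀ i, 0 ≤ β i)
    (hn : 1 ≤ n) (hv : ∀ i, 0 < v i) (hs : s < ∑ i, v i)
    (hsv : ∀ i, (∑ j, v j) - s < 2 * v i) (hy : y ∈ metaSectionCore v s) :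
    (∏ i, betaConst1 (β i) * (1 / (2 * ((n : ℝ) + 1) ^ 2)) ^ (β i)) *
      ((∑ i, v i) - s) ^ (∑ i, β i) * ∏ i, v i ^ (-(β i)) ≤ betaDensity β y := by
  have hD := sub_pos.2 hs
  rw [← prod_betaConst1_mul_rpow β (by positivity) hD hv]
  have hb : ∀ i, 0 < betaConst1 (β i) := fun i => betaConst1_pos (by linarith [hβ i])
  refine Finset.prod_le_prod (fun i _ => ?_) fun i _ => ?_
  · have := hb i
    have := hv i
    positivity
  · refine mul_le_mul_of_nonneg_left (Real.rpow_le_rpow ?_ ?_ (hβ i)) (hb i).le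
    · have := hv i
      positivity
    · obtain ⟨h1, h2⟩ := bounds_of_mem_metaSectionCore hn hv hs hsv hy i
      have h3 : 0 ≤ ((∑ j, v j) - s) / (2 * (n + 1)) / v i := by
        have := hv i
        positivity
      calc _ = ((∑ j, v j) - s) / (2 * (n + 1)) / v i * (1 / ((n : ℝ) + 1)) := by
            have := (hv i).ne'
            field_simp
        _ ≤ (1 - y i) * (1 + y i) := mul_le_mul h1 h2 (by positivity) (h3.trans h1)
        _ = _ := by ring

end

lemma betaDensity_le_of_mem_metaSection {m : ℕ} {β : Fin m → ℝ} (hβ : ∀ i, 0 ≤ β i)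
    {v y : EuclideanSpace ℝ (Fin m)} {s : ℝ} (hv : ∀ i, 0 < v i) (hs : s < ∑ i, v i)
    (hy : y ∈ metaSection v s) :
    betaDensity β y ≤ (∏ i, betaConst1 (β i) * 2 ^ (β i)) *
      ((∑ i, v i) - s) ^ (∑ i, β i) * ∏ i, v i ^ (-(β i)) := by
  have hD := sub_pos.2 hs
  rw [← prod_betaConst1_mul_rpow β (by positivity) hD hv]
  have hb : ∀ i, 0 < betaConst1 (β i) := fun i => betaConst1_pos (by linarith [hβ i])
  have hsq : ∀ i, 0 ≤ 1 - y i ^ 2 := fun i =>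
    sub_nonneg.2 ((sq_le_one_iff_abs_le_one _).2 (hy.1 i))
  refine Finset.prod_le_prod (fun i _ => mul_nonneg (hb i).le (Real.rpow_nonneg (hsq i) _))
    fun i _ => mul_le_mul_of_nonneg_left (Real.rpow_le_rpow (hsq i) ?_ (hβ i)) (hb i).le
  have h1 := one_sub_mul_le_of_mem_metaSection hv hy i
  have h2 := abs_le.1 (hy.1 i)
  have h3 : 1 - y i ≤ ((∑ j, v j) - s) / v i := by
    rw [le_div_iff₀ (hv i)]; linarith
  rw [mul_div_assoc]
  nlinarith

lemma le_hausdorffMeasure_metaSectionCore {n : ℕ} {v : EuclideanSpace ℝ (Fin (n + 1))} {s : ℝ}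
    (hnorm : ‖v‖ = 1) (hv : ∀ i, 0 < v i) (hs : s < ∑ i, v i) :
    ENNReal.ofReal ((1 / (2 * ((n : ℝ) + 1))) ^ n * (1 / (n + 1)) * ((∑ i, v i) - s) ^ n /
      ∏ i, v i) ≤ μH[(n : ℝ)] (metaSectionCore v s) := by
  obtain ⟨i, hi⟩ := Finite.exists_max (fun j => v j)
  set D := (∑ j, v j) - s with hD
  have hDpos : 0 < D := sub_pos.2 hs
  have hvi : 1 / ((n : ℝ) + 1) ≤ v i := by
    have h1 : ∑ j, v j ^ 2 = 1 := by
      have := EuclideanSpace.real_norm_sq_eq v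
      rw [← this, hnorm, one_pow]
    have h2 : ∀ j, v j ≤ 1 := fun j => by
      have := PiLp.norm_apply_le v j
      rw [hnorm] at this
      exact (le_abs_self _).trans this
    have h3 : ∑ j, v j ^ 2 ≤ ∑ j : Fin (n + 1), v i := Finset.sum_le_sum fun j _ => by
      nlinarith [hv j, h2 j, hi j]
    rw [h1] at h3
    rw [div_le_iff₀ (by positivity), mul_comm]
    simpa using h3
  refine le_trans (ENNReal.ofReal_le_ofReal ?_) (le_hausdorffMeasure_of_Icc (v := v) (s := s) (i := i)
    (a := fun j => 1 - D / (n + 1) / v (i.succAbove j))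
    (b := fun j => 1 - D / (2 * (n + 1)) / v (i.succAbove j)) ?_ ?_)
  · have h : ∀ j, 1 - D / (2 * (n + 1)) / v (i.succAbove j) -
        (1 - D / (n + 1) / v (i.succAbove j)) = D / (2 * (n + 1)) / v (i.succAbove j) := by
      intro j
      have := (hv (i.succAbove j)).ne'
      field_simp
      ring
    simp only [h]
    rw [prod_const_div_succAbove (v := v) hv]
    have : 0 < ∏ j, v j := Finset.prod_pos fun j _ => hv j
    gcongr ?_ / _
    calc _ = (D / (2 * (n + 1))) ^ n * (1 / (n + 1)) := by rw [div_pow, div_pow, one_pow]; field_simp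
      _ ≤ _ := by gcongr
  · intro j
    have := hv (i.succAbove j)
    dsimp only
    gcongr
    linarith
  · intro x hx
    have hinner := inner_hyperplaneGraph s (hv i).ne' x
    have hj : ∀ j, D / (2 * (n + 1)) ≤ v (i.succAbove j) * (1 - x j) ∧
        v (i.succAbove j) * (1 - x j) ≤ D / (n + 1) := fun j => by
      have h1 := hx.1 j
      have h2 := hx.2 j
      dsimp only at h1 h2
      have hp := hv (i.succAbove j)
      constructor
      · rw [← div_le_iff₀' hp]; linarith
      · rw [← le_div_iff₀' hp]; linarith
    have hsucc : ∀ j, hyperplaneGraph v s i x (i.succAbove j) = x j := fun j => by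
      simp [hyperplaneGraph]
    refine ⟨fun k => ?_, hinner⟩
    push_cast
    refine Fin.succAboveCases i ?_ (fun j => ?_) k
    · rw [inner_eq_sum_mul] at hinner
      have hsum : ∑ j, v j * (1 - hyperplaneGraph v s i x j) = D := by
        simp [mul_sub, hD, hinner]
      rw [Fin.sum_univ_succAbove _ i] at hsum
      simp only [hsucc] at hsum
      have h1 : ∑ j, v (i.succAbove j) * (1 - x j) ≤ n * (D / (n + 1)) :=
        (Finset.sum_le_card_nsmul _ _ _ fun j _ => (hj j).2).trans (by simp)
      have h2 : n * (D / ((n : ℝ) + 1)) = D - 2 * (D / (2 * (n + 1))) := by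
        field_simp; ring
      have h3 : 0 < D / (2 * ((n : ℝ) + 1)) := by positivity
      linarith
    · rw [hsucc]
      exact (hj j).1

lemma hausdorffMeasure_metaSection_le {n : ℕ} {v : EuclideanSpace ℝ (Fin (n + 1))} {s : ℝ}
    (hnorm : ‖v‖ = 1) (hv : ∀ i, 0 < v i) (hs : s < ∑ i, v i) :
    μH[(n : ℝ)] (metaSection v s) ≤
      ENNReal.ofReal ((2 * n) ^ n * ((∑ i, v i) - s) ^ n / ∏ i, v i) := by
  obtain ⟨i, hi⟩ := Finite.exists_max (fun j => v j)
  set D := (∑ j, v j) - s with hD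
  have hDpos : 0 < D := sub_pos.2 hs
  have hvi : v i ≤ 1 := by
    have := PiLp.norm_apply_le v i
    rw [hnorm] at this
    exact (le_abs_self _).trans this
  refine (hausdorffMeasure_le_of_comp_succAbove_mem_Icc hv hi
    (a := fun j => 1 - D / v (i.succAbove j)) (b := fun _ => 1) (fun j => ?_)
    (fun y hy => hy.2) (fun y hy => ⟨fun j => ?_, fun j => (abs_le.1 (hy.1 _)).2⟩)).trans
    (ENNReal.ofReal_le_ofReal ?_)
  · have := hv (i.succAbove j)
    simp only [sub_le_self_iff]
    positivity
  · have h := one_sub_mul_le_of_mem_metaSection hv hy (i.succAbove j)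
    rw [mul_comm, ← le_div_iff₀ (hv _)] at h
    dsimp only
    linarith
  · simp only [sub_sub_cancel]
    rw [prod_const_div_succAbove (v := v) hv]
    have : 0 < ∏ j, v j := Finset.prod_pos fun j _ => hv j
    have h : D ^ n * v i / ∏ j, v j ≤ D ^ n / ∏ j, v j :=
      div_le_div_of_nonneg_right (mul_le_of_le_one_right (by positivity) hvi) this.le
    exact (mul_le_mul_of_nonneg_left h (by positivity)).trans (mul_div_assoc _ _ _).ge

lemma metaSectionContent_bounds {n : ℕ} (hn : 1 ≤ n) {β : Fin (n + 1) → ℝ}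
    (hβ : ∀ i, 0 ≤ β i) {v : EuclideanSpace ℝ (Fin (n + 1))} {s : ℝ}
    (hnorm : ‖v‖ = 1) (hv : ∀ i, 0 < v i) (hs : s < ∑ i, v i)
    (hsv : ∀ i, (∑ j, v j) - s < 2 * v i) :
    ((∏ i, betaConst1 (β i) * (1 / (2 * ((n : ℝ) + 1) ^ 2)) ^ (β i)) *
        ((1 / (2 * ((n : ℝ) + 1))) ^ n * (1 / (n + 1)))) *
        (((∑ i, v i) - s) ^ ((∑ i, β i) + n) * ∏ i, v i ^ (-(β i) - 1))
        ≤ metaSectionContent β v s ∧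
      metaSectionContent β v s ≤ ((∏ i, betaConst1 (β i) * 2 ^ (β i)) * (2 * n) ^ n) *
        (((∑ i, v i) - s) ^ ((∑ i, β i) + n) * ∏ i, v i ^ (-(β i) - 1)) := by
  have hdim : ((n + 1 : ℕ) : ℝ) - 1 = n := by push_cast; ring
  have hcontent : metaSectionContent β v s =
      ∫ y in metaSection v s, betaDensity β y ∂μH[(n : ℝ)] := by
    rw [metaSectionContent, hdim]; rfl
  rw [hcontent]
  have hD : 0 < (∑ i, v i) - s := sub_pos.2 hs
  have hmeas := hausdorffMeasure_metaSection_le hnorm hv hs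
  have hcore := le_hausdorffMeasure_metaSectionCore hnorm hv hs
  have hsub := metaSectionCore_subset hn hv hs hsv
  have hfin : μH[(n : ℝ)] (metaSection v s) < ⊤ := hmeas.trans_lt ENNReal.ofReal_lt_top
  have hfinc : μH[(n : ℝ)] (metaSectionCore v s) < ⊤ := (measure_mono hsub).trans_lt hfin
  have hprod : 0 < ∏ i, v i := Finset.prod_pos fun i _ => hv i
  have hprod' : 0 < ∏ i, v i ^ (-(β i)) := Finset.prod_pos fun i _ => Real.rpow_pos_of_pos (hv i) _
  have hb : ∀ i, 0 < betaConst1 (β i) := fun i => betaConst1_pos (by linarith [hβ i])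
  have hconst : ∀ a : ℝ, 0 < a → 0 < ∏ i, betaConst1 (β i) * a ^ (β i) := fun a ha =>
    Finset.prod_pos fun i _ => mul_pos (hb i) (Real.rpow_pos_of_pos ha _)
  have hnn : ∀ y ∈ metaSection v s, 0 ≤ betaDensity β y := fun y hy =>
    betaDensity_nonneg hβ hy.1
  have hle : ∀ y ∈ metaSection v s, ‖betaDensity β y‖ ≤ (∏ i, betaConst1 (β i) * 2 ^ (β i)) *
      ((∑ i, v i) - s) ^ (∑ i, β i) * ∏ i, v i ^ (-(β i)) := fun y hy => by
    rw [Real.norm_of_nonneg (hnn y hy)]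
    exact betaDensity_le_of_mem_metaSection hβ hv hs hy
  have hmC := (isClosed_metaSection v s).measurableSet
  have hint : IntegrableOn (betaDensity β) (metaSection v s) μH[(n : ℝ)] :=
    Measure.integrableOn_of_bounded hfin.ne (continuous_betaDensity hβ).aestronglyMeasurable
      ((ae_restrict_iff' hmC).2 (Eventually.of_forall hle))
  rw [Real.rpow_add hD, Real.rpow_natCast, prod_rpow_neg_sub_one (v := v) β hv]
  constructor
  · have h1 := setIntegral_ge_of_const_le_real (isClosed_metaSectionCore v s).measurableSet
      hfinc.ne (fun y hy => le_betaDensity_of_mem_metaSectionCore hβ hn hv hs hsv hy)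
      (hint.mono_set hsub)
    have h2 := setIntegral_mono_set hint ((ae_restrict_iff' hmC).2 (Eventually.of_forall hnn))
      hsub.eventuallyLE
    refine le_trans ?_ (h1.trans h2)
    have h3 := (ENNReal.ofReal_le_iff_le_toReal hfinc.ne).1 hcore
    refine le_trans (le_of_eq ?_) (mul_le_mul_of_nonneg_left h3 ?_)
    · ring
    · have := hconst (1 / (2 * ((n : ℝ) + 1) ^ 2)) (by positivity)
      positivity
  · refine (Real.le_norm_self _).trans
      ((norm_setIntegral_le_of_norm_le_const hfin hle).trans ?_)
    have h3 := ENNReal.toReal_le_of_le_ofReal (by positivity) hmeas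
    refine le_trans (mul_le_mul_of_nonneg_left h3 ?_) (le_of_eq ?_)
    · have := hconst 2 two_pos
      positivity
    · ring

lemma metaSectionContent_fin_one {β : Fin 1 → ℝ} {v : EuclideanSpace ℝ (Fin 1)} {s : ℝ}
    (hv : v 0 = 1) (hs0 : 0 < s) (hs1 : s < 1) :
    metaSectionContent β v s = betaConst1 (β 0) * (1 + s) ^ (β 0) * (1 - s) ^ (β 0) := by
  have hset : metaSection v s = {WithLp.toLp 2 fun _ => s} := by
    ext y
    simp only [metaSection, inner_eq_sum_mul, Set.mem_ofPred_eq, Set.mem_singleton_iff]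
    constructor
    · rintro ⟨-, h⟩
      ext k
      rw [Subsingleton.elim k 0]
      simpa [hv] using h
    · rintro rfl
      simpa [hv, abs_le] using ⟨by linarith, hs1.le⟩
  have hdim : ((1 : ℕ) : ℝ) - 1 = 0 := by simp
  rw [metaSectionContent, hset, hdim, integral_singleton]
  have : (1 : ℝ) - s ^ 2 = (1 + s) * (1 - s) := by ring
  simp [Measure.real, this]
  rw [Real.mul_rpow (by linarith) (by linarith), mul_assoc]

lemma min_one_two_rpow_le {x b : ℝ} (h1 : 1 ≤ x) (h2 : x ≤ 2) :
    min 1 ((2 : ℝ) ^ b) ≤ x ^ b ∧ x ^ b ≤ max 1 ((2 : ℝ) ^ b) := by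
  rcases le_total 0 b with hb | hb
  · exact ⟨(min_le_left _ _).trans (Real.one_le_rpow h1 hb),
      (Real.rpow_le_rpow (by linarith) h2 hb).trans (le_max_right _ _)⟩
  · exact ⟨(min_le_right _ _).trans (Real.rpow_le_rpow_of_nonpos (by linarith) h2 hb),
      (Real.rpow_le_one_of_one_le_of_nonpos h1 hb).trans (le_max_left _ _)⟩

/-- **Lemma 3.4**: for `v ∈ S_+^{m−1}` with all `v_i > 0` and
`s ∈ (max{s_1(v),0}, ‖v‖_1)`, where `s_1(v) = ‖v‖_1 − 2 min_i v_i`, the weighted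
surface content of the meta-section satisfies
`Vol_{m−1}(C(v,s);β) ≍ (‖v‖_1−s)^{β+m−1} ∏_i v_i^{−β_i−1}`. -/
theorem metaSection_content_near_vertex
    (m : ℕ) (hm : 1 ≤ m) (β : Fin m → ℝ) (hβ : ∀ i, -1 < β i)
    (hβ0 : 2 ≤ m → ∀ i, 0 ≤ β i) :
    ∃ c C : ℝ, 0 < c ∧ c ≤ C ∧
      ∀ (v : EuclideanSpace ℝ (Fin m)) (s : ℝ),
        ‖v‖ = 1 → (∀ i, 0 < v i) →
        max ((∑ i, v i) -
            2 * Finset.univ.inf' ⟨⟨0, hm⟩, Finset.mem_univ _⟩ (fun i => v i)) 0 < s →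
        s < ∑ i, v i →
        (c * ((∑ i, v i) - s) ^ ((∑ i, β i) + m - 1) * ∏ i, v i ^ (-(β i) - 1)
            ≤ metaSectionContent β v s) ∧
        metaSectionContent β v s
          ≤ C * ((∑ i, v i) - s) ^ ((∑ i, β i) + m - 1) * ∏ i, v i ^ (-(β i) - 1) := by
  obtain ⟨n, rfl⟩ : ∃ n, m = n + 1 := ⟨m - 1, by omega⟩
  have hb : ∀ i, 0 < betaConst1 (β i) := fun i => betaConst1_pos (hβ i)
  have hexp : (∑ i, β i) + ((n + 1 : ℕ) : ℝ) - 1 = (∑ i, β i) + n := by push_cast; ring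
  simp only [hexp]
  rcases Nat.eq_zero_or_pos n with rfl | hn
  · refine ⟨betaConst1 (β 0) * min 1 (2 ^ (β 0)), betaConst1 (β 0) * max 1 (2 ^ (β 0)),
      mul_pos (hb 0) (by positivity), mul_le_mul_of_nonneg_left min_le_max (hb 0).le, ?_⟩
    intro v s hnorm hv hmax hs
    have hv0 : v 0 = 1 := by
      have h := EuclideanSpace.real_norm_sq_eq v
      rw [hnorm] at h
      rw [Fin.sum_univ_one] at h
      have := hv 0
      nlinarith
    have hsum : ∑ i, v i = 1 := by simpa using hv0
    rw [hsum] at hs ⊢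
    have hs0 : 0 < s := (le_max_right _ _).trans_lt hmax
    rw [metaSectionContent_fin_one hv0 hs0 hs]
    have hp : 0 ≤ (1 - s) ^ (β 0) := Real.rpow_nonneg (by linarith) _
    obtain ⟨h1, h2⟩ := min_one_two_rpow_le (b := β 0) (show 1 ≤ 1 + s by linarith)
      (by linarith)
    have hprod : ∏ i, v i ^ (-(β i) - 1) = 1 := by simp [hv0]
    have hβsum : (∑ i, β i) + ((0 : ℕ) : ℝ) = β 0 := by simp
    rw [hprod, hβsum, mul_one, mul_one]
    exact ⟨mul_le_mul_of_nonneg_right (mul_le_mul_of_nonneg_left h1 (hb 0).le) hp,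
      mul_le_mul_of_nonneg_right (mul_le_mul_of_nonneg_left h2 (hb 0).le) hp⟩
  · have hβ' := hβ0 (by omega)
    have hn' : (0 : ℝ) < n := by exact_mod_cast hn
    have hconst : ∀ a : ℝ, 0 < a → 0 < ∏ i, betaConst1 (β i) * a ^ (β i) := fun a ha =>
      Finset.prod_pos fun i _ => mul_pos (hb i) (Real.rpow_pos_of_pos ha _)
    refine ⟨min ((∏ i, betaConst1 (β i) * (1 / (2 * ((n : ℝ) + 1) ^ 2)) ^ (β i)) *
        ((1 / (2 * ((n : ℝ) + 1))) ^ n * (1 / (n + 1))))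
        ((∏ i, betaConst1 (β i) * 2 ^ (β i)) * (2 * n) ^ n),
      (∏ i, betaConst1 (β i) * 2 ^ (β i)) * (2 * n) ^ n, ?_, min_le_right _ _, ?_⟩
    · have h1 := hconst (1 / (2 * ((n : ℝ) + 1) ^ 2)) (by positivity)
      have h2 := hconst 2 two_pos
      positivity
    intro v s hnorm hv hmax hs
    have hsv : ∀ i, (∑ j, v j) - s < 2 * v i := fun i => by
      have h1 := (le_max_left _ _).trans_lt hmax
      have h2 := Finset.inf'_le (fun i => v i) (Finset.mem_univ i)
      linarith
    obtain ⟨h1, h2⟩ := metaSectionContent_bounds hn hβ' hnorm hv hs hsv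
    rw [mul_assoc, mul_assoc]
    refine ⟨le_trans (mul_le_mul_of_nonneg_right (min_le_left _ _) ?_) h1, h2⟩
    exact mul_nonneg (Real.rpow_nonneg (sub_pos.2 hs).le _)
      (Finset.prod_nonneg fun i _ => Real.rpow_nonneg (hv i).le _)
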